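/- Let G be a connected balanced grid graph on a finite set V ⊆ ℤ², and let B = {(x, y) ∈ ℤ² : min_x ≤ x ≤ max_x, min_y ≤ y ≤ max_y} be the bounding box of V. Let H be the king's graph on B. Define colorings f, f′ of H by: f(x, y) = 1 if x + y is odd and f(x, y) = 2 if x + y is even; f′(v) = 3 − f(v) for v ∈ V and f′(v) = f(v) for v ∈ B ∖ V. Then G has a Hamiltonian path if and only if there is a walk in H of length at most |V| − 1 that transforms f into f′. -/

import Mathlib

/-- Swap the colors of vertices `a` and `b`. -/
def swapC {V C : Type*} [DecidableEq V] (f : V → C) (a b : V) : V → C :=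
  fun v => if v = a then f b else if v = b then f a else f v

/-- The coloring obtained from `f` by sequentially swapping the colors of
consecutive vertices along the list (walk) of vertices. -/
def transformList {V C : Type*} [DecidableEq V] : List V → (V → C) → (V → C)
  | [], f => f
  | [_], f => f
  | a :: b :: rest, f => transformList (b :: rest) (swapC f a b)

/-- Grid adjacency on `ℤ²`: two points are adjacent iff their L¹-distance
is `1`. -/
def gridAdj (a b : ℤ × ℤ) : Prop := |a.1 - b.1| + |a.2 - b.2| = 1

instance : ∀ a b, Decidable (gridAdj a b) := fun a b => by
  unfold gridAdj; infer_instance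

/-- King adjacency on `ℤ²`: two distinct points are adjacent iff their
L∞-distance is `1`. -/
def kingAdj (a b : ℤ × ℤ) : Prop :=
  a ≠ b ∧ max |a.1 - b.1| |a.2 - b.2| = 1

/-- A point `(x, y)` of `ℤ²` is even if `x + y` is even. -/
def evenPt (p : ℤ × ℤ) : Prop := (p.1 + p.2) % 2 = 0

instance : ∀ p, Decidable (evenPt p) := fun p => by
  unfold evenPt; infer_instance

/-- A finite set of grid points is balanced if it has equally many even and
odd points. -/
def BalancedPts (V : Finset (ℤ × ℤ)) : Prop :=
  (V.filter (fun p => evenPt p)).card = (V.filter (fun p => ¬ evenPt p)).card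

/-- The graph with vertex set `S` and adjacency `A` is connected: any two
vertices of `S` are joined by a walk staying inside `S`. -/
def ConnOn (S : Set (ℤ × ℤ)) (A : ℤ × ℤ → ℤ × ℤ → Prop) : Prop :=
  ∀ a ∈ S, ∀ b ∈ S, ∃ l : List (ℤ × ℤ), (∀ x ∈ l, x ∈ S) ∧ l.Chain' A ∧
    l.head? = some a ∧ l.getLast? = some b

/-- The grid graph on `S` has a Hamiltonian path. -/
def HamPathOn (S : Finset (ℤ × ℤ)) : Prop :=
  ∃ l : List (ℤ × ℤ), l.Chain' gridAdj ∧ l.Nodup ∧ ∀ x, x ∈ l ↔ x ∈ S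

theorem swapC_of_ne {V C : Type*} [DecidableEq V] (f : V → C) {a b v : V} (ha : v ≠ a)
    (hb : v ≠ b) : swapC f a b v = f v := by
  simp [swapC, ha, hb]

theorem swapC_left {V C : Type*} [DecidableEq V] (f : V → C) (a b : V) :
    swapC f a b a = f b := by
  simp [swapC]

theorem swapC_right {V C : Type*} [DecidableEq V] (f : V → C) (a b : V) :
    swapC f a b b = f a := by
  by_cases h : b = a <;> simp [swapC, h]

/-- Vertices off the walk keep their color. -/
theorem transformList_of_notMem {V C : Type*} [DecidableEq V] (l : List V) (f : V → C) {v : V}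
    (hv : v ∉ l) : transformList l f v = f v := by
  induction l generalizing f with
  | nil => rfl
  | cons a t ih =>
    cases t with
    | nil => rfl
    | cons b r =>
      simp only [List.mem_cons, not_or] at hv
      rw [transformList, ih _ (by simp [hv.2.1, hv.2.2]), swapC_of_ne f hv.1 hv.2.1]

/-- A path moves the color of its second vertex to its first vertex. -/
theorem transformList_head {V C : Type*} [DecidableEq V] (a b : V) (r : List V) (f : V → C)
    (ha : a ∉ b :: r) : transformList (a :: b :: r) f a = f b := by
  rw [transformList, transformList_of_notMem _ _ ha, swapC_left]

theorem gridAdj.evenPt_iff {a b : ℤ × ℤ} (h : gridAdj a b) : evenPt a ↔ ¬ evenPt b := by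
  simp only [gridAdj, abs_eq_max_neg] at h
  unfold evenPt
  omega

theorem gridAdj.kingAdj {a b : ℤ × ℤ} (h : gridAdj a b) : kingAdj a b := by
  refine ⟨?_, ?_⟩
  · rintro rfl
    simp [gridAdj] at h
  · simp only [gridAdj, abs_eq_max_neg] at h ⊢
    omega

theorem kingAdj.gridAdj {a b : ℤ × ℤ} (h : kingAdj a b) (hp : evenPt a ↔ ¬ evenPt b) :
    gridAdj a b := by
  have h1 := h.2
  unfold evenPt at hp
  simp only [_root_.gridAdj, abs_eq_max_neg] at h1 ⊢
  omega

/-- The chessboard coloring of `ℤ²`: `2` on even points, `1` on odd points. -/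
def chessColor (p : ℤ × ℤ) : ℕ := if evenPt p then 2 else 1

theorem chessColor_eq_sub_iff (a b : ℤ × ℤ) :
    chessColor b = 3 - chessColor a ↔ (evenPt a ↔ ¬ evenPt b) := by
  unfold chessColor
  split_ifs <;> simp [*]

theorem chessColor_ne_sub (a : ℤ × ℤ) : 3 - chessColor a ≠ chessColor a := by
  unfold chessColor
  split_ifs <;> simp

/-- The ends of a grid path have equal parity exactly when it has oddly many vertices. -/
theorem evenPt_iff_getLast_iff_odd_length (a : ℤ × ℤ) (t : List (ℤ × ℤ))
    (h : (a :: t).IsChain gridAdj) :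
    (evenPt a ↔ evenPt ((a :: t).getLast (List.cons_ne_nil a t))) ↔ Odd (a :: t).length := by
  induction t generalizing a with
  | nil => simp
  | cons b r ih =>
    rw [List.isChain_cons_cons] at h
    have h1 := h.1.evenPt_iff
    have h2 := ih b h.2
    rw [List.getLast_cons (List.cons_ne_nil b r), List.length_cons, Nat.odd_add_one, ← h2]
    tauto

/-- If the first vertex of a grid path carries the color wanted at the last one, then walking
along the path reverses the chessboard coloring on it. -/
theorem transformList_eq_sub_of_gridPath (a : ℤ × ℤ) (t : List (ℤ × ℤ)) (g : ℤ × ℤ → ℕ)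
    (h : (a :: t).IsChain gridAdj) (hd : (a :: t).Nodup) (hg : ∀ v ∈ t, g v = chessColor v)
    (ha : g a = 3 - chessColor ((a :: t).getLast (List.cons_ne_nil a t))) :
    ∀ v ∈ a :: t, transformList (a :: t) g v = 3 - chessColor v := by
  induction t generalizing a g with
  | nil => simpa [transformList] using ha
  | cons b r ih =>
    rw [List.isChain_cons_cons] at h
    rw [List.nodup_cons] at hd
    intro v hv
    rcases List.mem_cons.1 hv with rfl | hv
    · rw [transformList_head _ _ _ _ hd.1, hg b (by simp)]
      exact (chessColor_eq_sub_iff _ _).2 h.1.evenPt_iff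
    · refine ih b (swapC g a b) h.2 hd.2 (fun w hw => ?_) ?_ v hv
      · rw [swapC_of_ne, hg w (by simp [hw])]
        · rintro rfl
          exact hd.1 (by simp [hw])
        · rintro rfl
          exact (List.nodup_cons.1 hd.2).1 hw
      · rw [swapC_right, ha, List.getLast_cons (List.cons_ne_nil b r)]

/-- A path of the king's graph reversing the chessboard coloring is a path of the grid. -/
theorem isChain_gridAdj_of_transformList (a : ℤ × ℤ) (t : List (ℤ × ℤ)) (g : ℤ × ℤ → ℕ)
    (h : (a :: t).IsChain kingAdj) (hd : (a :: t).Nodup) (hg : ∀ v ∈ t, g v = chessColor v)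
    (ht : ∀ v ∈ a :: t, transformList (a :: t) g v = 3 - chessColor v) :
    (a :: t).IsChain gridAdj := by
  induction t generalizing a g with
  | nil => simp
  | cons b r ih =>
    rw [List.isChain_cons_cons] at h ⊢
    rw [List.nodup_cons] at hd
    refine ⟨h.1.gridAdj ((chessColor_eq_sub_iff _ _).1 ?_),
      ih b (swapC g a b) h.2 hd.2 (fun w hw => ?_) fun v hv => ht v (List.mem_cons_of_mem _ hv)⟩
    · rw [← ht a (by simp), transformList_head _ _ _ _ hd.1, hg b (by simp)]
    · rw [swapC_of_ne, hg w (by simp [hw])]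
      · rintro rfl
        exact hd.1 (by simp [hw])
      · rintro rfl
        exact (List.nodup_cons.1 hd.2).1 hw

theorem BalancedPts.even_card {V : Finset (ℤ × ℤ)} (h : BalancedPts V) : Even V.card := by
  rw [← Finset.card_filter_add_card_filter_not (s := V) (fun p => evenPt p)]
  exact ⟨_, congrArg _ h.symm⟩

/-- let `G` be a connected balanced grid graph on a finite
`V ⊆ ℤ²`, `B` the bounding box of `V`, and `H` the king's graph on `B`.
With `f` coloring odd points `1` and even points `2`, and `f'` flipping `f`
exactly on `V`, the graph `G` has a Hamiltonian path iff there is a walk in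
`H` of length at most `|V| - 1` transforming `f` into `f'`. -/
theorem ham_path_iff_swap_walk_kings (V : Finset (ℤ × ℤ)) (hne : V.Nonempty)
    (hconn : ConnOn (↑V) gridAdj) (hbal : BalancedPts V) :
    let B : Finset (ℤ × ℤ) :=
      (Finset.Icc ((V.image Prod.fst).min' (hne.image _))
          ((V.image Prod.fst).max' (hne.image _))) ×ˢ
        (Finset.Icc ((V.image Prod.snd).min' (hne.image _))
          ((V.image Prod.snd).max' (hne.image _)))
    let f : ℤ × ℤ → ℕ := fun p => if evenPt p then 2 else 1
    let f' : ℤ × ℤ → ℕ := fun p => if p ∈ V then 3 - f p else f p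
    HamPathOn V ↔
      ∃ m : List (ℤ × ℤ), (∀ x ∈ m, x ∈ B) ∧ m.Chain' kingAdj ∧ m ≠ [] ∧
        transformList m f = f' ∧ m.length - 1 ≤ V.card - 1 := by
  intro B f f'
  have hf : f = chessColor := rfl
  have hf' : ∀ p, f' p = if p ∈ V then 3 - chessColor p else chessColor p := fun p => rfl
  constructor
  · rintro ⟨l, hc, hd, hl⟩
    have hV : l.toFinset = V := by
      ext x
      simp [hl]
    have hcard : l.length = V.card := by rw [← hV, List.toFinset_card_of_nodup hd]
    obtain ⟨v₀, hv₀⟩ := hne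
    have hne' : l ≠ [] := List.ne_nil_of_mem ((hl v₀).2 hv₀)
    refine ⟨l, fun x hx => ?_, List.IsChain.imp (fun _ _ h => h.kingAdj) hc, hne', ?_, by omega⟩
    · have hx := (hl x).1 hx
      have h1 := Finset.mem_image_of_mem Prod.fst hx
      have h2 := Finset.mem_image_of_mem Prod.snd hx
      exact Finset.mem_product.2
        ⟨Finset.mem_Icc.2 ⟨Finset.min'_le _ _ h1, Finset.le_max' _ _ h1⟩,
          Finset.mem_Icc.2 ⟨Finset.min'_le _ _ h2, Finset.le_max' _ _ h2⟩⟩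
    · funext v
      rw [hf, hf' v]
      split_ifs with hv
      · cases l with
        | nil => exact absurd rfl hne'
        | cons a t =>
          refine transformList_eq_sub_of_gridPath a t _ hc hd (fun _ _ => rfl) ?_ v ((hl v).2 hv)
          rw [chessColor_eq_sub_iff]
          have h1 := evenPt_iff_getLast_iff_odd_length a t hc
          rw [hcard, ← Nat.not_even_iff_odd, iff_false_intro (not_not.2 hbal.even_card)] at h1
          tauto
      · exact transformList_of_notMem _ _ fun h => hv ((hl v).1 h)
  · rintro ⟨m, -, hc, hm, ht, hlen⟩
    have hsub : V ⊆ m.toFinset := by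
      intro v hv
      by_contra hvm
      have h1 := congrFun ht v
      rw [transformList_of_notMem _ _ (by simpa using hvm), hf, hf' v, if_pos hv] at h1
      exact chessColor_ne_sub v h1.symm
    have hpos := Finset.card_pos.2 hne
    have hle : m.length ≤ V.card := by omega
    have hV : V = m.toFinset :=
      Finset.eq_of_subset_of_card_le hsub (m.toFinset_card_le.trans hle)
    have hd : m.Nodup :=
      Multiset.toFinset_card_eq_card_iff_nodup.1
        (le_antisymm m.toFinset_card_le (hle.trans (Finset.card_le_card hsub)))
    have hmem : ∀ x, x ∈ m ↔ x ∈ V := fun x => by rw [hV, List.mem_toFinset]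
    refine ⟨m, ?_, hd, hmem⟩
    cases m with
    | nil => exact absurd rfl hm
    | cons a t =>
      refine isChain_gridAdj_of_transformList a t chessColor hc hd (fun _ _ => rfl) fun v hv => ?_
      have h1 := congrFun ht v
      rwa [hf, hf' v, if_pos ((hmem v).1 hv)] at h1
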